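/- Let R be a commutative ring and let M, N be any R-modules. Then tr_R(M)·tr_R(N) ⊆ tr_R(M ⊗_R N) ⊆ tr_R(M) ∩ tr_R(N). -/

import Mathlib

open TensorProduct

/-- The trace ideal of a module `M`: the sum of the ranges of all linear maps `M → R`. -/
def traceIdeal (R : Type*) [CommRing R] (M : Type*) [AddCommGroup M] [Module R M] :
    Ideal R :=
  ⨆ f : M →ₗ[R] R, LinearMap.range f

theorem apply_mem_traceIdeal {R M : Type*} [CommRing R] [AddCommGroup M] [Module R M]
    (f : M →ₗ[R] R) (m : M) : f m ∈ traceIdeal R M :=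
  (le_iSup (fun f : M →ₗ[R] R => LinearMap.range f) f) (LinearMap.mem_range_self f m)

theorem traceIdeal_le_iff {R M : Type*} [CommRing R] [AddCommGroup M] [Module R M]
    {I : Ideal R} : traceIdeal R M ≤ I ↔ ∀ (f : M →ₗ[R] R) (m : M), f m ∈ I := by
  refine ⟨fun h f m => h (apply_mem_traceIdeal f m), fun h => iSup_le fun f => ?_⟩
  rintro _ ⟨m, rfl⟩
  exact h f m

theorem traceIdeal_mul_le_tensorProduct (R M N : Type*) [CommRing R]
    [AddCommGroup M] [Module R M] [AddCommGroup N] [Module R N] :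
    traceIdeal R M * traceIdeal R N ≤ traceIdeal R (M ⊗[R] N) := by
  rw [traceIdeal, traceIdeal, Submodule.mul_iSup]
  simp only [Submodule.iSup_mul]
  refine iSup_le fun g => iSup_le fun f => Ideal.mul_le.2 ?_
  rintro _ ⟨m, rfl⟩ _ ⟨n, rfl⟩
  simpa using apply_mem_traceIdeal (LinearMap.mul' R R ∘ₗ TensorProduct.map f g) (m ⊗ₜ[R] n)

theorem traceIdeal_tensorProduct_le_inf (R M N : Type*) [CommRing R]
    [AddCommGroup M] [Module R M] [AddCommGroup N] [Module R N] :
    traceIdeal R (M ⊗[R] N) ≤ traceIdeal R M ⊓ traceIdeal R N := by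
  refine traceIdeal_le_iff.2 fun f x => ?_
  induction x with
  | zero => simp
  | add x y hx hy => simpa using add_mem hx hy
  | tmul m n =>
    exact ⟨apply_mem_traceIdeal (f ∘ₗ (TensorProduct.mk R M N).flip n) m,
      apply_mem_traceIdeal (f ∘ₗ TensorProduct.mk R M N m) n⟩

/-- For any two modules `M`, `N`:
`tr_R(M) · tr_R(N) ⊆ tr_R(M ⊗_R N) ⊆ tr_R(M) ∩ tr_R(N)`. -/
theorem traceIdeal_tensor_between (R M N : Type*) [CommRing R]
    [AddCommGroup M] [Module R M] [AddCommGroup N] [Module R N] :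
    traceIdeal R M * traceIdeal R N ≤ traceIdeal R (M ⊗[R] N) ∧
      traceIdeal R (M ⊗[R] N) ≤ traceIdeal R M ⊓ traceIdeal R N :=
  ⟨traceIdeal_mul_le_tensorProduct R M N, traceIdeal_tensorProduct_le_inf R M N⟩
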